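/- For all integers p, q ≥ 1, in SL₂(ℤ) one has φ_A^p · φ_B^{-2} · φ_A^{-(q+1)} · φ_B = [[2pq + p - q, 2pq + 3p - q - 1], [2q + 1, 2q + 3]]; in particular the trace of this matrix equals 2pq + p + q + 3, which is strictly greater than 2. -/

import Mathlib

/-- The matrix induced by a Dehn twist along the curve `A`. -/
def phiA : Matrix.SpecialLinearGroup (Fin 2) ℤ :=
  ⟨!![1, 1; 0, 1], by norm_num [Matrix.det_fin_two_of]⟩

/-- The matrix induced by a Dehn twist along the curve `B`. -/
def phiB : Matrix.SpecialLinearGroup (Fin 2) ℤ :=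
  ⟨!![1, 0; 1, 1], by norm_num [Matrix.det_fin_two_of]⟩

theorem phiA_zpow (n : ℤ) :
    ((phiA ^ n : Matrix.SpecialLinearGroup (Fin 2) ℤ) : Matrix (Fin 2) (Fin 2) ℤ) =
      !![1, n; 0, 1] :=
  ModularGroup.coe_T_zpow n

theorem phiB_zpow_neg_two :
    ((phiB ^ (-2 : ℤ) : Matrix.SpecialLinearGroup (Fin 2) ℤ) : Matrix (Fin 2) (Fin 2) ℤ) =
      !![1, 0; -2, 1] := by
  decide

/-- For all integers `p, q ≥ 1`, in `SL₂(ℤ)` one has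
`φ_A^p · φ_B^{-2} · φ_A^{-(q+1)} · φ_B = [[2pq + p - q, 2pq + 3p - q - 1], [2q + 1, 2q + 3]]`;
its trace is `2pq + p + q + 3`, which is strictly greater than `2`. -/
theorem stmt_4 (p q : ℤ) (hp : 1 ≤ p) (hq : 1 ≤ q) :
    ((phiA ^ p * phiB ^ (-2 : ℤ) * phiA ^ (-(q + 1)) * phiB :
        Matrix.SpecialLinearGroup (Fin 2) ℤ) : Matrix (Fin 2) (Fin 2) ℤ) =
      !![2 * p * q + p - q, 2 * p * q + 3 * p - q - 1; 2 * q + 1, 2 * q + 3] ∧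
    Matrix.trace ((phiA ^ p * phiB ^ (-2 : ℤ) * phiA ^ (-(q + 1)) * phiB :
        Matrix.SpecialLinearGroup (Fin 2) ℤ) : Matrix (Fin 2) (Fin 2) ℤ) =
      2 * p * q + p + q + 3 ∧
    2 < Matrix.trace ((phiA ^ p * phiB ^ (-2 : ℤ) * phiA ^ (-(q + 1)) * phiB :
        Matrix.SpecialLinearGroup (Fin 2) ℤ) : Matrix (Fin 2) (Fin 2) ℤ) := by
  have key : ((phiA ^ p * phiB ^ (-2 : ℤ) * phiA ^ (-(q + 1)) * phiB :
        Matrix.SpecialLinearGroup (Fin 2) ℤ) : Matrix (Fin 2) (Fin 2) ℤ) =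
      !![2 * p * q + p - q, 2 * p * q + 3 * p - q - 1; 2 * q + 1, 2 * q + 3] := by
    have hB : (phiB : Matrix (Fin 2) (Fin 2) ℤ) = !![1, 0; 1, 1] := rfl
    rw [Matrix.SpecialLinearGroup.coe_mul, Matrix.SpecialLinearGroup.coe_mul,
      Matrix.SpecialLinearGroup.coe_mul, phiA_zpow, phiA_zpow, phiB_zpow_neg_two, hB]
    ext i j
    fin_cases i <;> fin_cases j <;> simp [Matrix.mul_apply, Fin.sum_univ_two] <;> ring
  have htr : Matrix.trace ((phiA ^ p * phiB ^ (-2 : ℤ) * phiA ^ (-(q + 1)) * phiB :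
        Matrix.SpecialLinearGroup (Fin 2) ℤ) : Matrix (Fin 2) (Fin 2) ℤ) =
      2 * p * q + p + q + 3 := by
    rw [key, Matrix.trace_fin_two_of]
    ring
  refine ⟨key, htr, ?_⟩
  rw [htr]
  have : 0 ≤ p * q := mul_nonneg (by linarith) (by linarith)
  nlinarith
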